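/- For a skew-symmetric 2n×2n matrix A over a commutative ring, the square of the Pfaffian equals the determinant: pf(A)² = det(A). -/

import Mathlib

open Matrix

/-- The Pfaffian of a `2n × 2n` matrix over a field of characteristic zero. -/
noncomputable def pfaffian {K : Type*} [Field K] [CharZero K] {n : ℕ}
    (A : Matrix (Fin (2 * n)) (Fin (2 * n)) K) : K :=
  ((2 : K) ^ n * n.factorial)⁻¹ *
    ∑ σ : Equiv.Perm (Fin (2 * n)), (Equiv.Perm.sign σ : ℤ) *
      ∏ i : Fin n, A (σ ⟨2 * i.1, by have := i.isLt; omega⟩)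
                     (σ ⟨2 * i.1 + 1, by have := i.isLt; omega⟩)


namespace PfAux

variable {K : Type*} [Field K]

/-- Unnormalized Pfaffian on the index type `Fin 2 × Fin n`. -/
def S {n : ℕ} (A : Matrix (Fin 2 × Fin n) (Fin 2 × Fin n) K) : K :=
  ∑ σ : Equiv.Perm (Fin 2 × Fin n), ((Equiv.Perm.sign σ : ℤ) : K) *
    ∏ i : Fin n, A (σ (0, i)) (σ (1, i))

/-- The standard symplectic matrix. -/
def J (K : Type*) [Field K] (n : ℕ) : Matrix (Fin 2 × Fin n) (Fin 2 × Fin n) K :=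
  blockDiagonal fun _ => !![0, 1; -1, 0]

lemma det_J (n : ℕ) : (J K n).det = 1 := by
  simp [J, det_blockDiagonal, det_fin_two]

lemma prod_pair {n : ℕ} (g : Fin 2 × Fin n → K) :
    ∏ x, g x = ∏ i : Fin n, g (0, i) * g (1, i) := by
  rw [Fintype.prod_prod_type_right]
  simp [Fin.prod_univ_two]

/-- A function from the index type is the same as a family of pairs. -/
def pairEquiv (n : ℕ) : ((Fin n → (Fin 2 × Fin n) × (Fin 2 × Fin n))) ≃
    (Fin 2 × Fin n → Fin 2 × Fin n) where
  toFun h x := if x.1 = 0 then (h x.2).1 else (h x.2).2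
  invFun f i := (f (0, i), f (1, i))
  left_inv h := by ext i <;> simp
  right_inv f := by
    funext ⟨b, i⟩
    fin_cases b <;> simp

lemma S_congr {n : ℕ} (A C : Matrix (Fin 2 × Fin n) (Fin 2 × Fin n) K) :
    S (C * A * Cᵀ) = C.det * S A := by
  have hentry : ∀ a b, (C * A * Cᵀ) a b =
      ∑ p : (Fin 2 × Fin n) × (Fin 2 × Fin n), A p.1 p.2 * (C a p.1 * C b p.2) := by
    intro a b
    rw [Fintype.sum_prod_type_right]
    simp only [Matrix.mul_apply, Matrix.transpose_apply, Finset.sum_mul]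
    refine Finset.sum_congr rfl fun y _ => Finset.sum_congr rfl fun x _ => by ring
  have h1 : S (C * A * Cᵀ) = ∑ f : Fin 2 × Fin n → Fin 2 × Fin n,
      (∏ i : Fin n, A (f (0, i)) (f (1, i))) * (C.submatrix id f).det := by
    unfold S
    simp only [hentry, Finset.prod_univ_sum, Fintype.piFinset_univ, Finset.mul_sum,
      det_apply']
    rw [Finset.sum_comm, ← (pairEquiv n).sum_comp]
    refine Finset.sum_congr rfl fun h _ => Finset.sum_congr rfl fun σ _ => ?_
    rw [prod_pair, Finset.prod_mul_distrib]
    simp [pairEquiv]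
    ring
  rw [h1, S, Finset.mul_sum]
  symm
  refine Finset.sum_of_injOn (fun σ : Equiv.Perm (Fin 2 × Fin n) => (σ : _ → _))
    (fun a _ b _ h => DFunLike.coe_injective h) (by simp) ?_ ?_
  · intro f _ hf
    have hni : ¬ Function.Injective f := by
      intro hinj
      exact hf ⟨Equiv.ofBijective f (Finite.injective_iff_bijective.1 hinj), by simp, rfl⟩
    simp only [Function.Injective, not_forall] at hni
    obtain ⟨a, b, hab, hne⟩ := hni
    rw [det_zero_of_column_eq hne (by intro k; simp [hab]), mul_zero]
  · intro σ _
    rw [Matrix.det_permute']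
    ring

lemma J_apply {n : ℕ} (a b : Fin 2) (i j : Fin n) :
    J K n (a, i) (b, j) = if i = j then (!![0, 1; -1, 0] : Matrix (Fin 2) (Fin 2) K) a b else 0 := by
  simp [J, blockDiagonal_apply]

lemma sign_two (e : Equiv.Perm (Fin 2)) :
    (!![0, 1; -1, 0] : Matrix (Fin 2) (Fin 2) K) (e 0) (e 1) =
      ((Equiv.Perm.sign e : ℤ) : K) := by
  have : e = 1 ∨ e = Equiv.swap 0 1 := by revert e; decide
  rcases this with rfl | rfl <;> simp

/-- Block preserving permutations. -/
def bp {n : ℕ} (x : Equiv.Perm (Fin n) × (Fin n → Equiv.Perm (Fin 2))) :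
    Equiv.Perm (Fin 2 × Fin n) :=
  Equiv.prodCongrRight (fun _ : Fin 2 => x.1) * Equiv.prodCongrLeft x.2

lemma bp_apply {n : ℕ} (x : Equiv.Perm (Fin n) × (Fin n → Equiv.Perm (Fin 2)))
    (b : Fin 2) (i : Fin n) : bp x (b, i) = (x.2 i b, x.1 i) := by
  simp [bp]

lemma sign_bp {n : ℕ} (x : Equiv.Perm (Fin n) × (Fin n → Equiv.Perm (Fin 2))) :
    Equiv.Perm.sign (bp x) = ∏ i, Equiv.Perm.sign (x.2 i) := by
  rw [bp, Equiv.Perm.sign_mul, Equiv.Perm.sign_prodCongrRight, Equiv.Perm.sign_prodCongrLeft]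
  simp [Fin.prod_univ_two]

lemma bp_inj {n : ℕ} : Function.Injective (bp (n := n)) := by
  rintro ⟨t, e⟩ ⟨t', e'⟩ h
  have h2 : ∀ b i, (e i b, t i) = (e' i b, t' i) := by
    intro b i
    have := congrArg (fun σ => σ (b, i)) h
    simpa only [bp_apply] using this
  simp only [Prod.mk.injEq] at h2 ⊢
  refine ⟨Equiv.ext fun i => (h2 0 i).2, funext fun i => Equiv.ext fun b => (h2 b i).1⟩

lemma bp_surj {n : ℕ} (σ : Equiv.Perm (Fin 2 × Fin n))
    (h : ∀ i, (σ (0, i)).2 = (σ (1, i)).2) : ∃ x, bp x = σ := by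
  have hb : ∀ b i, (σ (b, i)).2 = (σ (0, i)).2 := by
    intro b i
    fin_cases b
    · rfl
    · exact (h i).symm
  have hs : Function.Surjective fun i => (σ (0, i)).2 := by
    intro j
    obtain ⟨⟨b, i⟩, hi⟩ := σ.surjective (0, j)
    exact ⟨i, by simp only; rw [← hb b i, hi]⟩
  have hinj : ∀ i, Function.Injective fun b => (σ (b, i)).1 := by
    intro i b c hbc
    have : σ (b, i) = σ (c, i) := Prod.ext hbc (by rw [hb b, hb c])
    simpa using this
  refine ⟨(Equiv.ofBijective _ (Finite.surjective_iff_bijective.1 hs),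
    fun i => Equiv.ofBijective _ (Finite.injective_iff_bijective.1 (hinj i))), ?_⟩
  ext1 ⟨b, i⟩
  rw [bp_apply]
  exact Prod.ext rfl (hb b i).symm

lemma S_J (n : ℕ) : S (J K n) = 2 ^ n * n.factorial := by
  have : S (J K n) = ∑ x : Equiv.Perm (Fin n) × (Fin n → Equiv.Perm (Fin 2)), (1 : K) := by
    symm
    refine Finset.sum_of_injOn bp (fun a _ b _ h => bp_inj h) (by simp) ?_ ?_
    · intro σ _ hσ
      have : ∃ i, (σ (0, i)).2 ≠ (σ (1, i)).2 := by
        by_contra! h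
        obtain ⟨x, hx⟩ := bp_surj σ h
        exact hσ ⟨x, by simp, hx⟩
      obtain ⟨i, hi⟩ := this
      rw [Finset.prod_eq_zero (Finset.mem_univ i), mul_zero]
      rw [← Prod.mk.eta (p := σ (0, i)), ← Prod.mk.eta (p := σ (1, i)), J_apply, if_neg hi]
    · intro x _
      simp only [bp_apply, J_apply, if_true, sign_two, sign_bp]
      push_cast
      rw [← Finset.prod_mul_distrib]
      symm
      refine Finset.prod_eq_one fun i _ => ?_
      rcases Int.units_eq_one_or (Equiv.Perm.sign (x.2 i)) with h | h <;> simp [h]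
  rw [this]
  simp [Fintype.card_perm, mul_comm]

open Classical in
lemma decomp {ι : Type*} [Fintype ι] [CharZero K] (m : ℕ) :
    ∀ A : ι → ι → K, (∀ i j, A j i = - A i j) →
      (Finset.univ.filter fun i => A i ≠ 0).card ≤ 2 * m →
      ∃ u v : Fin m → ι → K, ∀ i j, A i j = ∑ k, (u k i * v k j - v k i * u k j) := by
  induction m with
  | zero =>
    intro A _ hc
    refine ⟨0, 0, fun i j => ?_⟩
    have : (Finset.univ.filter fun i => A i ≠ 0) = ∅ := by
      rw [← Finset.card_eq_zero]; omega
    have hi : A i = 0 := by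
      by_contra h
      have : i ∈ (Finset.univ.filter fun i => A i ≠ 0) := by simp [h]
      simp_all
    simp [hi]
  | succ m ih =>
    intro A hA hc
    by_cases h0 : ∀ i j, A i j = 0
    · exact ⟨0, 0, fun i j => by simp [h0]⟩
    push Not at h0
    obtain ⟨p, q, ha⟩ := h0
    have hd : ∀ i, A i i = 0 := fun i => self_eq_neg.1 (hA i i)
    let A' : ι → ι → K := fun i j => A i j - (A p q)⁻¹ * (A i p * A j q - A i q * A j p)
    have hA' : ∀ i j, A' j i = - A' i j := by
      intro i j
      simp only [A', hA i j]; ring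
    have hp : A' p = 0 := by
      funext j
      simp only [A', hd, Pi.zero_apply, hA p j]
      field_simp
      ring
    have hq : A' q = 0 := by
      funext j
      simp only [A', hd, Pi.zero_apply, hA p q, hA q j]
      field_simp
      ring
    have hz : ∀ i, A i = 0 → A' i = 0 := by
      intro i hi
      funext j
      simp [A', hi]
    have hpq : p ≠ q := by
      rintro rfl
      exact ha (hd p)
    have hsub : insert p (insert q (Finset.univ.filter fun i => A' i ≠ 0)) ⊆
        (Finset.univ.filter fun i => A i ≠ 0) := by
      intro i hi
      simp only [Finset.mem_insert, Finset.mem_filter, Finset.mem_univ, true_and] at hi ⊢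
      rcases hi with rfl | rfl | hi
      · intro h; exact ha (by simp [h])
      · intro h; exact ha (by rw [hA i p, h]; simp)
      · exact fun h => hi (hz i h)
    have hcard := Finset.card_le_card hsub
    rw [Finset.card_insert_of_notMem (by simp [hp, hpq]),
      Finset.card_insert_of_notMem (by simp [hq])] at hcard
    obtain ⟨u, v, huv⟩ := ih A' hA' (by omega)
    refine ⟨Fin.cons (fun i => (A p q)⁻¹ * A i p) u, Fin.cons (fun i => A i q) v, fun i j => ?_⟩
    rw [Fin.sum_univ_succ]
    simp only [Fin.cons_zero, Fin.cons_succ, ← huv, A']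
    ring

lemma exists_congr [CharZero K] {n : ℕ} (A : Matrix (Fin 2 × Fin n) (Fin 2 × Fin n) K)
    (hA : Aᵀ = -A) : ∃ C, A = C * J K n * Cᵀ := by
  classical
  obtain ⟨u, v, h⟩ := decomp n (fun i j => A i j) (fun i j => congrFun (congrFun hA i) j)
    ((Finset.card_le_univ _).trans (by simp))
  refine ⟨Matrix.of fun x y => if y.1 = 0 then u y.2 x else v y.2 x, ?_⟩
  ext i j
  rw [h]
  simp only [Matrix.mul_apply, Fintype.sum_prod_type_right, Fin.sum_univ_two, J_apply]
  refine Finset.sum_congr rfl fun k _ => ?_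
  simp [Finset.sum_add_distrib]
  ring

/-- The index equivalence. -/
def idx (n : ℕ) : Fin 2 × Fin n ≃ Fin (2 * n) :=
  (Equiv.prodComm _ _).trans (finProdFinEquiv.trans (finCongr (mul_comm n 2)))

lemma pf_eq [CharZero K] {n : ℕ} (A : Matrix (Fin (2 * n)) (Fin (2 * n)) K) :
    pfaffian A = ((2 : K) ^ n * n.factorial)⁻¹ * S (A.submatrix (idx n) (idx n)) := by
  unfold pfaffian S
  congr 1
  rw [← (idx n).permCongr.sum_comp]
  refine Finset.sum_congr rfl fun σ _ => ?_
  rw [Equiv.Perm.sign_permCongr]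
  congr 1
  refine Finset.prod_congr rfl fun i _ => ?_
  have h0 : (idx n).symm ⟨2 * i.1, by have := i.isLt; omega⟩ = (0, i) := by
    rw [Equiv.symm_apply_eq]
    ext; simp [idx]
  have h1 : (idx n).symm ⟨2 * i.1 + 1, by have := i.isLt; omega⟩ = (1, i) := by
    rw [Equiv.symm_apply_eq]
    ext; simp [idx]; try omega
  simp only [Equiv.permCongr_apply, h0, h1, Matrix.submatrix_apply]

end PfAux

/-- The square of the Pfaffian of a skew-symmetric matrix equals its determinant. -/
theorem pfaffian_sq_eq_det {K : Type*} [Field K] [CharZero K] {n : ℕ}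
    (A : Matrix (Fin (2 * n)) (Fin (2 * n)) K) (hA : Aᵀ = -A) :
    pfaffian A ^ 2 = A.det := by
  rw [PfAux.pf_eq, ← Matrix.det_submatrix_equiv_self (PfAux.idx n) A]
  have hB : (A.submatrix (PfAux.idx n) (PfAux.idx n))ᵀ =
      -(A.submatrix (PfAux.idx n) (PfAux.idx n)) := by
    rw [Matrix.transpose_submatrix, hA]
    rfl
  obtain ⟨C, hC⟩ := PfAux.exists_congr _ hB
  rw [hC, PfAux.S_congr, PfAux.S_J, Matrix.det_mul, Matrix.det_mul, Matrix.det_transpose,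
    PfAux.det_J]
  have h : ((2 : K) ^ n * n.factorial) ≠ 0 :=
    mul_ne_zero (pow_ne_zero _ two_ne_zero) (Nat.cast_ne_zero.2 n.factorial_ne_zero)
  rw [mul_comm C.det, inv_mul_cancel_left₀ h]
  ring
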